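/- arXiv:2409.19547 — 4 statements merged into one kernel-verified Lean document; each statement's English description precedes it below -/
import Mathlib

section
/- For every integer n ≥ 1 and each pattern σ ∈ {123, 132, 231}, the number of desarrangements of length n avoiding both 213 and σ equals the Jacobsthal number J_{n−1}, i.e. d_n({213, σ}) = J_{n−1}. -/
open scoped Classical

/-- Index `i ∈ {1,…,n}` (1-indexed) is an ascent of the permutation `π` of length `n`,
written in one-line notation `π₁π₂⋯πₙ` with `πᵢ = π ⟨i-1, _⟩`: either `i = n`, or
`πᵢ < πᵢ₊₁`. -/
def IsAscent (n : ℕ) (π : Equiv.Perm (Fin n)) (i : ℕ) : Prop :=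
  1 ≤ i ∧ i ≤ n ∧ (i = n ∨ ∃ h : i < n, π ⟨i - 1, by omega⟩ < π ⟨i, h⟩)

/-- A permutation is a desarrangement if it is empty or its first (smallest) ascent is even. -/
def IsDesarrangement (n : ℕ) (π : Equiv.Perm (Fin n)) : Prop :=
  n = 0 ∨ ∃ i, IsAscent n π i ∧ Even i ∧ ∀ j, IsAscent n π j → i ≤ j

/-- `π` contains the pattern `σ` (where `σ` is given in 0-indexed one-line notation):
there are positions `i₁ < ⋯ < i_k` such that the letters of `π` at these positions are
in the same relative order as the letters of `σ`. -/
def ContainsPattern {k n : ℕ} (σ : Fin k → Fin k) (π : Equiv.Perm (Fin n)) : Prop :=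
  ∃ f : Fin k ↪o Fin n, ∀ a b : Fin k, π (f a) < π (f b) ↔ σ a < σ b

/-- `d_n(P)`: the number of desarrangements of length `n` avoiding every pattern in `P`
(patterns of length 3, in 0-indexed one-line notation). -/
noncomputable def dcount (n : ℕ) (P : Finset (Fin 3 → Fin 3)) : ℕ :=
  (Finset.univ.filter fun π : Equiv.Perm (Fin n) =>
    IsDesarrangement n π ∧ ∀ σ ∈ P, ¬ ContainsPattern σ π).card

/-- Insert the letter `v` at position `p` of `π`, shifting up the letters that are at least `v`. -/
def insertLetter {n : ℕ} (p v : Fin (n + 1)) (π : Equiv.Perm (Fin n)) :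
    Equiv.Perm (Fin (n + 1)) :=
  (finSuccEquiv' p).trans ((Equiv.optionCongr π).trans (finSuccEquiv' v).symm)

@[simp] lemma insertLetter_self {n : ℕ} (p v : Fin (n + 1)) (π : Equiv.Perm (Fin n)) :
    insertLetter p v π p = v := by
  simp [insertLetter]

@[simp] lemma insertLetter_succAbove {n : ℕ} (p v : Fin (n + 1)) (π : Equiv.Perm (Fin n))
    (i : Fin n) : insertLetter p v π (p.succAbove i) = v.succAbove (π i) := by
  simp [insertLetter]

lemma insertLetter_injective {n : ℕ} (p v : Fin (n + 1)) :
    Function.Injective (insertLetter p v) := by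
  intro π τ h
  ext1 i
  have := congrArg (fun ρ => ρ (p.succAbove i)) h
  simpa using this

lemma exists_insertLetter_eq {n : ℕ} (p : Fin (n + 1)) (π : Equiv.Perm (Fin (n + 1))) :
    ∃ τ, insertLetter p (π p) τ = π := by
  let e : Option (Fin n) ≃ Option (Fin n) :=
    (finSuccEquiv' p).symm.trans (π.trans (finSuccEquiv' (π p)))
  have he : e none = none := by simp [e]
  refine ⟨Equiv.removeNone e, ?_⟩
  ext1 i
  rcases Fin.eq_self_or_eq_succAbove p i with rfl | ⟨j, rfl⟩
  · simp
  · rw [insertLetter_succAbove]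
    have h : some (Equiv.removeNone e j) = e (some j) := by
      apply Equiv.removeNone_some
      by_contra hc
      have : e (some j) = none := by
        cases h : e (some j) with
        | none => rfl
        | some x => exact absurd ⟨x, h⟩ hc
      exact absurd (e.injective (this.trans he.symm)) (by simp)
    have h2 := congrArg (finSuccEquiv' (π p)).symm h
    simpa [e] using h2

lemma containsPattern_iff_lt {n : ℕ} (σ : Fin 3 → Fin 3) (π : Equiv.Perm (Fin n)) :
    ContainsPattern σ π ↔ ∃ f : Fin 3 → Fin n, f 0 < f 1 ∧ f 1 < f 2 ∧
      ∀ a b : Fin 3, π (f a) < π (f b) ↔ σ a < σ b := by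
  constructor
  · rintro ⟨f, hf⟩
    exact ⟨f, f.lt_iff_lt.2 (by decide), f.lt_iff_lt.2 (by decide), hf⟩
  · rintro ⟨f, h0, h1, hf⟩
    refine ⟨OrderEmbedding.ofStrictMono f (Fin.strictMono_iff_lt_succ.2 ?_), hf⟩
    intro i
    fin_cases i
    · exact h0
    · exact h1

/-- An occurrence of a pattern in `insertLetter p v π` that misses `p` is one in `π`. -/
lemma containsPattern_of_forall_ne {k n : ℕ} {σ : Fin k → Fin k} {π : Equiv.Perm (Fin n)}
    {p v : Fin (n + 1)} (f : Fin k ↪o Fin (n + 1)) (hp : ∀ a, f a ≠ p)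
    (hf : ∀ a b, insertLetter p v π (f a) < insertLetter p v π (f b) ↔ σ a < σ b) :
    ContainsPattern σ π := by
  choose g hg using fun a => Fin.exists_succAbove_eq (hp a)
  refine ⟨OrderEmbedding.ofStrictMono g fun a b hab => ?_, fun a b => ?_⟩
  · rw [← Fin.succAbove_lt_succAbove_iff (p := p), hg, hg]
    exact f.lt_iff_lt.2 hab
  · rw [← hf, ← hg a, ← hg b, insertLetter_succAbove, insertLetter_succAbove,
      Fin.succAbove_lt_succAbove_iff]
    rfl

lemma ContainsPattern.insertLetter {k n : ℕ} {σ : Fin k → Fin k} {π : Equiv.Perm (Fin n)}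
    (h : ContainsPattern σ π) (p v : Fin (n + 1)) : ContainsPattern σ (insertLetter p v π) := by
  obtain ⟨f, hf⟩ := h
  exact ⟨f.trans (Fin.succAboveOrderEmb p), fun a b => by simp [hf]⟩

lemma containsPattern_insertLetter_last {n k : ℕ} {σ : Fin (k + 1) → Fin (k + 1)}
    {π : Equiv.Perm (Fin n)} (hσ : ∃ b, σ 0 < σ b) :
    ContainsPattern σ (insertLetter 0 (Fin.last n) π) ↔ ContainsPattern σ π := by
  refine ⟨fun ⟨f, hf⟩ => containsPattern_of_forall_ne f (fun a ha => ?_) hf,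
    fun h => h.insertLetter _ _⟩
  obtain ⟨b, hb⟩ := hσ
  have h0 : f 0 = 0 := le_antisymm (ha ▸ f.monotone (Fin.zero_le a)) (Fin.zero_le _)
  have := (hf 0 b).2 hb
  rw [h0, insertLetter_self] at this
  exact absurd this (Fin.le_last _).not_gt

lemma containsPattern_insertLetter_zero {n k : ℕ} {σ : Fin (k + 1) → Fin (k + 1)}
    {π : Equiv.Perm (Fin n)} (hσ : ∃ b, σ b < σ 0) :
    ContainsPattern σ (insertLetter 0 0 π) ↔ ContainsPattern σ π := by
  refine ⟨fun ⟨f, hf⟩ => containsPattern_of_forall_ne f (fun a ha => ?_) hf,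
    fun h => h.insertLetter _ _⟩
  obtain ⟨b, hb⟩ := hσ
  have h0 : f 0 = 0 := le_antisymm (ha ▸ f.monotone (Fin.zero_le a)) (Fin.zero_le _)
  have := (hf b 0).2 hb
  rw [h0, insertLetter_self] at this
  exact absurd this (Fin.zero_le _).not_gt

lemma containsPattern_insertLetter_one_last {n : ℕ} {σ : Fin 3 → Fin 3}
    {π : Equiv.Perm (Fin (n + 1))} (h0 : σ 0 < σ 2) (h1 : σ 1 < σ 2) :
    ContainsPattern σ (insertLetter 1 (Fin.last (n + 1)) π) ↔ ContainsPattern σ π := by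
  refine ⟨fun ⟨f, hf⟩ => containsPattern_of_forall_ne f (fun a ha => ?_) hf,
    fun h => h.insertLetter _ _⟩
  have h01 : f 0 < f 1 := f.lt_iff_lt.2 (by decide)
  have h12 : f 1 < f 2 := f.lt_iff_lt.2 (by decide)
  have hlt : σ a < σ 2 := by
    fin_cases a
    · exact h0
    · exact h1
    · have ha' : f 2 = 1 := ha
      rw [ha'] at h12
      simp only [Fin.lt_def, Fin.val_one] at h01 h12
      omega
  have := (hf a 2).2 hlt
  rw [ha, insertLetter_self] at this
  exact absurd this (Fin.le_last _).not_gt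

/-- Insert a new first letter immediately below the first letter of `π`. -/
def duplicateFirst {n : ℕ} (π : Equiv.Perm (Fin (n + 1))) : Equiv.Perm (Fin (n + 2)) :=
  insertLetter 0 (π 0).castSucc π

@[simp] lemma duplicateFirst_zero {n : ℕ} (π : Equiv.Perm (Fin (n + 1))) :
    duplicateFirst π 0 = (π 0).castSucc := insertLetter_self _ _ _

@[simp] lemma duplicateFirst_succ {n : ℕ} (π : Equiv.Perm (Fin (n + 1))) (i : Fin (n + 1)) :
    duplicateFirst π i.succ = (π 0).castSucc.succAbove (π i) :=
  insertLetter_succAbove 0 _ π i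

lemma duplicateFirst_one {n : ℕ} (π : Equiv.Perm (Fin (n + 1))) :
    duplicateFirst π 1 = (π 0).succ := by
  simpa using duplicateFirst_succ π 0

lemma duplicateFirst_injective {n : ℕ} : Function.Injective (duplicateFirst (n := n)) := by
  intro π τ h
  have h0 : (π 0).castSucc = (τ 0).castSucc := by
    rw [← duplicateFirst_zero, ← duplicateFirst_zero, h]
  refine insertLetter_injective 0 (π 0).castSucc ?_
  rw [duplicateFirst, duplicateFirst, ← h0] at h
  exact h

lemma containsPattern_duplicateFirst {n : ℕ} {σ : Fin 3 → Fin 3}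
    {π : Equiv.Perm (Fin (n + 1))} (hσ : σ 1 < σ 0 ∨ (σ 0 < σ 2 ∧ σ 2 < σ 1)) :
    ContainsPattern σ (duplicateFirst π) ↔ ContainsPattern σ π := by
  refine ⟨fun ⟨f, hf⟩ => ?_, fun h => h.insertLetter _ _⟩
  by_cases hp : ∀ a, f a ≠ 0
  · exact containsPattern_of_forall_ne f hp hf
  push Not at hp
  obtain ⟨a, ha⟩ := hp
  have h0 : f 0 = 0 := le_antisymm (ha ▸ f.monotone (Fin.zero_le a)) (Fin.zero_le _)
  have h01 : f 0 < f 1 := f.lt_iff_lt.2 (by decide)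
  have h12 : f 1 < f 2 := f.lt_iff_lt.2 (by decide)
  obtain ⟨i, hi⟩ := Fin.exists_succ_eq.2 (h0 ▸ h01).ne'
  obtain ⟨j, hj⟩ := Fin.exists_succ_eq.2 ((Fin.zero_le _).trans_lt h12).ne'
  have hij : i < j := by rwa [← hi, ← hj, Fin.succ_lt_succ_iff] at h12
  have hadj : ∀ x : Fin (n + 1), (π 0).castSucc < (π 0).castSucc.succAbove x ↔ π 0 ≤ x := by
    intro x
    rw [Fin.lt_succAbove_iff_le_castSucc, Fin.castSucc_le_castSucc_iff]
  have hadj' : ∀ x : Fin (n + 1), (π 0).castSucc.succAbove x < (π 0).castSucc ↔ x < π 0 := by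
    intro x
    rw [Fin.succAbove_lt_iff_castSucc_lt, Fin.castSucc_lt_castSucc_iff]
  have e01 := hf 0 1
  have e10 := hf 1 0
  have e02 := hf 0 2
  have e20 := hf 2 0
  have e12 := hf 1 2
  have e21 := hf 2 1
  rw [h0, ← hi, duplicateFirst_zero, duplicateFirst_succ, hadj] at e01
  rw [h0, ← hi, duplicateFirst_zero, duplicateFirst_succ, hadj'] at e10
  rw [h0, ← hj, duplicateFirst_zero, duplicateFirst_succ, hadj] at e02
  rw [h0, ← hj, duplicateFirst_zero, duplicateFirst_succ, hadj'] at e20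
  rw [← hi, ← hj, duplicateFirst_succ, duplicateFirst_succ, Fin.succAbove_lt_succAbove_iff] at e12
  rw [← hi, ← hj, duplicateFirst_succ, duplicateFirst_succ, Fin.succAbove_lt_succAbove_iff] at e21
  have hi0 : 0 < i := by
    rw [Fin.pos_iff_ne_zero]
    rintro rfl
    rcases hσ with h | ⟨h, h'⟩
    · exact (e10.2 h).false
    · exact absurd (e02.2 h) (e21.2 h').not_ge
  have hne : π 0 ≠ π i := π.injective.ne hi0.ne
  have hne' : π 0 ≠ π j := π.injective.ne (hi0.trans hij).ne
  rw [hne.le_iff_lt] at e01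
  rw [hne'.le_iff_lt] at e02
  refine (containsPattern_iff_lt σ π).2 ⟨![0, i, j], hi0, hij, fun a b => ?_⟩
  fin_cases a <;> fin_cases b <;> simp [*]

lemma Fin.one_lt_of_ne_zero_of_ne_one {n : ℕ} {k : Fin (n + 2)} (h0 : k ≠ 0) (h1 : k ≠ 1) :
    1 < k := by
  simp only [ne_eq, Fin.ext_iff, Fin.val_zero, Fin.val_one, Fin.lt_def] at *
  omega

lemma apply_zero_eq_last {n : ℕ} {π : Equiv.Perm (Fin (n + 2))}
    (h213 : ¬ ContainsPattern ![1, 0, 2] π) (h : π 1 < π 0) : π 0 = Fin.last (n + 1) := by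
  by_contra hne
  have hlt : π 0 < Fin.last (n + 1) := Fin.lt_last_iff_ne_last.2 hne
  obtain ⟨k, hk⟩ := π.surjective (Fin.last (n + 1))
  rw [← hk] at hlt
  have hk0 : k ≠ 0 := by rintro rfl; exact hlt.false
  have hk1 : k ≠ 1 := by rintro rfl; exact (hlt.trans h).false
  refine h213 ((containsPattern_iff_lt _ π).2 ⟨![0, 1, k], by simp,
    Fin.one_lt_of_ne_zero_of_ne_one hk0 hk1, fun a b => ?_⟩)
  fin_cases a <;> fin_cases b <;> simp [h, hlt, h.trans hlt, h.le, hlt.le, (h.trans hlt).le]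

/-- If `π₁ < π₂`, then any third letter forms with them one of the three patterns. -/
lemma containsPattern_zero_one {n : ℕ} {π : Equiv.Perm (Fin (n + 2))} (h : π 0 < π 1)
    {k : Fin (n + 2)} (hk0 : k ≠ 0) (hk1 : k ≠ 1) :
    (π k < π 0 → ContainsPattern ![1, 2, 0] π) ∧
    (π 0 < π k → π k < π 1 → ContainsPattern ![0, 2, 1] π) ∧
    (π 1 < π k → ContainsPattern ![0, 1, 2] π) := by
  have h1k : 1 < k := Fin.one_lt_of_ne_zero_of_ne_one hk0 hk1
  refine ⟨fun hk => ?_, fun hk hk' => ?_, fun hk => ?_⟩ <;>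
  refine (containsPattern_iff_lt _ π).2 ⟨![0, 1, k], by simp, h1k, fun a b => ?_⟩
  · fin_cases a <;> fin_cases b <;> simp [h, hk, hk.trans h, h.le, hk.le, (hk.trans h).le]
  · fin_cases a <;> fin_cases b <;> simp [h, hk, hk', h.le, hk.le, hk'.le]
  · fin_cases a <;> fin_cases b <;> simp [h, hk, h.trans hk, h.le, hk.le, (h.trans hk).le]

/-- The permutations of length `n` avoiding 213 and `σ`. -/
noncomputable def avoiders (n : ℕ) (σ : Fin 3 → Fin 3) : Finset (Equiv.Perm (Fin n)) :=
  Finset.univ.filter fun π => ¬ ContainsPattern ![1, 0, 2] π ∧ ¬ ContainsPattern σ π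

lemma mem_avoiders {n : ℕ} {σ : Fin 3 → Fin 3} {π : Equiv.Perm (Fin n)} :
    π ∈ avoiders n σ ↔ ¬ ContainsPattern ![1, 0, 2] π ∧ ¬ ContainsPattern σ π := by
  simp [avoiders]

lemma insertLetter_last_mem_avoiders {n : ℕ} {σ : Fin 3 → Fin 3} (hσ : ∃ b, σ 0 < σ b)
    {π : Equiv.Perm (Fin n)} :
    insertLetter 0 (Fin.last n) π ∈ avoiders (n + 1) σ ↔ π ∈ avoiders n σ := by
  rw [mem_avoiders, mem_avoiders, containsPattern_insertLetter_last hσ,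
    containsPattern_insertLetter_last ⟨2, by decide⟩]

lemma card_filter_avoiders_descent {n : ℕ} {σ : Fin 3 → Fin 3} (hσ : ∃ b, σ 0 < σ b)
    (p : Equiv.Perm (Fin (n + 2)) → Prop) [DecidablePred p] (hp : ∀ π, p π → π 1 < π 0) :
    ((avoiders (n + 2) σ).filter p).card =
      ((avoiders (n + 1) σ).filter fun π => p (insertLetter 0 (Fin.last (n + 1)) π)).card := by
  rw [← Finset.card_image_of_injective _ (insertLetter_injective 0 (Fin.last (n + 1)))]
  congr 1
  ext π
  simp only [Finset.mem_filter, Finset.mem_image]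
  constructor
  · rintro ⟨h, hpi⟩
    obtain ⟨τ, hτ⟩ := exists_insertLetter_eq 0 π
    rw [apply_zero_eq_last (mem_avoiders.1 h).1 (hp π hpi)] at hτ
    subst hτ
    exact ⟨τ, ⟨(insertLetter_last_mem_avoiders hσ).1 h, hpi⟩, rfl⟩
  · rintro ⟨τ, ⟨h, hpi⟩, rfl⟩
    exact ⟨(insertLetter_last_mem_avoiders hσ).2 h, hpi⟩

lemma insertLetter_last_one_lt_zero {n : ℕ} (π : Equiv.Perm (Fin (n + 1))) :
    insertLetter 0 (Fin.last (n + 1)) π 1 < insertLetter 0 (Fin.last (n + 1)) π 0 := by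
  rw [insertLetter_self, Fin.lt_last_iff_ne_last]
  intro h
  have := (insertLetter 0 (Fin.last (n + 1)) π).injective (h.trans (insertLetter_self 0 _ π).symm)
  simp at this

lemma card_avoiders_add_two {n : ℕ} {σ : Fin 3 → Fin 3} (hσ : ∃ b, σ 0 < σ b)
    (g : Equiv.Perm (Fin (n + 1)) → Equiv.Perm (Fin (n + 2))) (hg : Function.Injective g)
    (hasc : ∀ π, g π 0 < g π 1) (hmem : ∀ π, g π ∈ avoiders (n + 2) σ ↔ π ∈ avoiders (n + 1) σ)
    (hsurj : ∀ π ∈ avoiders (n + 2) σ, π 0 < π 1 → ∃ τ, g τ = π) :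
    (avoiders (n + 2) σ).card = 2 * (avoiders (n + 1) σ).card := by
  rw [← Finset.card_filter_add_card_filter_not (s := avoiders (n + 2) σ) (fun π => π 1 < π 0),
    card_filter_avoiders_descent hσ _ fun _ h => h, two_mul]
  congr 1
  · rw [Finset.filter_true_of_mem fun π _ => insertLetter_last_one_lt_zero π]
  · rw [← Finset.card_image_of_injective (avoiders (n + 1) σ) hg]
    congr 1
    ext π
    simp only [Finset.mem_filter, Finset.mem_image]
    constructor
    · rintro ⟨h, hlt⟩
      have hne : π 0 ≠ π 1 := π.injective.ne (by simp)
      obtain ⟨τ, rfl⟩ := hsurj π h (lt_of_le_of_ne (not_lt.1 hlt) hne)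
      exact ⟨τ, (hmem τ).1 h, rfl⟩
    · rintro ⟨τ, h, rfl⟩
      exact ⟨(hmem τ).2 h, (hasc τ).not_gt⟩

lemma card_avoiders_123 (n : ℕ) : (avoiders (n + 2) ![0, 1, 2]).card =
    2 * (avoiders (n + 1) ![0, 1, 2]).card := by
  refine card_avoiders_add_two ⟨2, by decide⟩ (insertLetter 1 (Fin.last (n + 1)))
    (insertLetter_injective _ _) (fun π => ?_) (fun π => ?_) (fun π h hlt => ?_)
  · rw [insertLetter_self, Fin.lt_last_iff_ne_last]
    intro h
    have := (insertLetter 1 (Fin.last (n + 1)) π).injective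
      (h.trans (insertLetter_self 1 _ π).symm)
    simp at this
  · rw [mem_avoiders, mem_avoiders, containsPattern_insertLetter_one_last (by decide) (by decide),
      containsPattern_insertLetter_one_last (by decide) (by decide)]
  · obtain ⟨τ, hτ⟩ := exists_insertLetter_eq 1 π
    have : π 1 = Fin.last (n + 1) := by
      by_contra hne
      obtain ⟨k, hk⟩ := π.surjective (Fin.last (n + 1))
      have hlt' : π 1 < π k := hk ▸ Fin.lt_last_iff_ne_last.2 hne
      refine (mem_avoiders.1 h).2 ((containsPattern_zero_one hlt ?_ ?_).2.2 hlt') <;> rintro rfl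
      · exact (hlt.trans hlt').false
      · exact hlt'.false
    exact ⟨τ, by rwa [this] at hτ⟩

lemma card_avoiders_132 (n : ℕ) : (avoiders (n + 2) ![0, 2, 1]).card =
    2 * (avoiders (n + 1) ![0, 2, 1]).card := by
  refine card_avoiders_add_two ⟨2, by decide⟩ duplicateFirst
    duplicateFirst_injective (fun π => ?_) (fun π => ?_) (fun π h hlt => ?_)
  · rw [duplicateFirst_zero, duplicateFirst_one]
    exact Fin.castSucc_lt_succ
  · rw [mem_avoiders, mem_avoiders, containsPattern_duplicateFirst (by decide),
      containsPattern_duplicateFirst (by decide)]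
  · obtain ⟨τ, hτ⟩ := exists_insertLetter_eq 0 π
    have hsucc : (π 1 : ℕ) = π 0 + 1 := by
      by_contra hne
      have hlt' := Fin.lt_def.1 hlt
      obtain ⟨k, hk⟩ := π.surjective ⟨π 0 + 1, by omega⟩
      have hk' := congrArg Fin.val hk
      simp only at hk'
      refine (mem_avoiders.1 h).2 ((containsPattern_zero_one hlt (k := k) ?_ ?_).2.1 ?_ ?_)
      · rintro rfl; omega
      · rintro rfl; omega
      · rw [Fin.lt_def]; omega
      · rw [Fin.lt_def]; omega
    have h1 : π 1 = (π 0).succAbove (τ 0) := by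
      conv_lhs => rw [← hτ]
      exact insertLetter_succAbove 0 _ τ 0
    refine ⟨τ, ?_⟩
    have h0 : (τ 0).castSucc = π 0 := by
      rw [h1] at hsucc
      ext
      rw [Fin.val_castSucc]
      unfold Fin.succAbove at hsucc
      split_ifs at hsucc with hc
      · rw [Fin.lt_def] at hc
        simp only [Fin.val_castSucc] at hc hsucc
        omega
      · simpa using hsucc
    rw [duplicateFirst, h0, hτ]

lemma card_avoiders_231 (n : ℕ) : (avoiders (n + 2) ![1, 2, 0]).card =
    2 * (avoiders (n + 1) ![1, 2, 0]).card := by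
  refine card_avoiders_add_two ⟨1, by decide⟩ (insertLetter 0 0)
    (insertLetter_injective _ _) (fun π => ?_) (fun π => ?_) (fun π h hlt => ?_)
  · rw [insertLetter_self, Fin.pos_iff_ne_zero]
    intro h
    have := (insertLetter 0 0 π).injective (h.trans (insertLetter_self 0 _ π).symm)
    simp at this
  · rw [mem_avoiders, mem_avoiders, containsPattern_insertLetter_zero ⟨1, by decide⟩,
      containsPattern_insertLetter_zero ⟨2, by decide⟩]
  · obtain ⟨τ, hτ⟩ := exists_insertLetter_eq 0 π
    have : π 0 = 0 := by
      by_contra hne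
      obtain ⟨k, hk⟩ := π.surjective 0
      have hlt' : π k < π 0 := hk ▸ Fin.pos_iff_ne_zero.2 hne
      refine (mem_avoiders.1 h).2 ((containsPattern_zero_one hlt ?_ ?_).1 hlt') <;> rintro rfl
      · exact hlt'.false
      · exact (hlt.trans hlt').false
    exact ⟨τ, by rwa [this] at hτ⟩

lemma not_containsPattern_of_lt {k n : ℕ} (h : n < k) (σ : Fin k → Fin k)
    (π : Equiv.Perm (Fin n)) : ¬ ContainsPattern σ π := by
  rintro ⟨f, -⟩
  have := Fintype.card_le_of_injective f f.injective
  simp at this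
  omega

lemma card_avoiders {σ : Fin 3 → Fin 3}
    (hσ : σ = ![0, 1, 2] ∨ σ = ![0, 2, 1] ∨ σ = ![1, 2, 0]) (n : ℕ) :
    (avoiders (n + 1) σ).card = 2 ^ n := by
  induction n with
  | zero =>
    rw [avoiders, Finset.filter_true_of_mem fun π _ =>
      ⟨not_containsPattern_of_lt (by decide) _ π, not_containsPattern_of_lt (by decide) _ π⟩]
    simp
  | succ n ih =>
    rw [pow_succ', ← ih]
    rcases hσ with rfl | rfl | rfl
    · exact card_avoiders_123 n
    · exact card_avoiders_132 n
    · exact card_avoiders_231 n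

lemma isAscent_insertLetter_last {n : ℕ} (π : Equiv.Perm (Fin (n + 1))) (i : ℕ) :
    IsAscent (n + 2) (insertLetter 0 (Fin.last (n + 1)) π) (i + 1) ↔ IsAscent (n + 1) π i := by
  rcases i with _ | i
  · have := insertLetter_last_one_lt_zero π
    simp only [IsAscent]
    constructor
    · rintro ⟨-, -, h | ⟨_, h⟩⟩
      · omega
      · exact absurd h this.not_gt
    · omega
  · have key : ∀ (j : ℕ) (hj : j < n + 1) (hj' : j + 1 < n + 2),
        insertLetter 0 (Fin.last (n + 1)) π ⟨j + 1, hj'⟩ = (π ⟨j, hj⟩).castSucc := by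
      intro j hj hj'
      have := insertLetter_succAbove 0 (Fin.last (n + 1)) π ⟨j, hj⟩
      rwa [Fin.succAbove_last, Fin.succAbove_zero] at this
    simp only [IsAscent, Nat.add_sub_cancel]
    refine and_congr (by omega) (and_congr (by omega) (or_congr (by omega) ?_))
    constructor
    · rintro ⟨h, hlt⟩
      rw [key i (by omega), key (i + 1) (by omega), Fin.castSucc_lt_castSucc_iff] at hlt
      exact ⟨by omega, hlt⟩
    · rintro ⟨h, hlt⟩
      refine ⟨by omega, ?_⟩
      rwa [key i (by omega), key (i + 1) (by omega), Fin.castSucc_lt_castSucc_iff]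

lemma isDesarrangement_insertLetter_last {n : ℕ} (π : Equiv.Perm (Fin (n + 1))) :
    IsDesarrangement (n + 2) (insertLetter 0 (Fin.last (n + 1)) π) ↔
      ¬ IsDesarrangement (n + 1) π := by
  have hex : ∃ i, IsAscent (n + 1) π i := ⟨n + 1, by omega, le_rfl, Or.inl rfl⟩
  have hfind := Nat.find_spec hex
  have hmin : ∀ j, IsAscent (n + 1) π j → Nat.find hex ≤ j := fun j hj => Nat.find_min' hex hj
  have hD : IsDesarrangement (n + 1) π ↔ Even (Nat.find hex) := by
    constructor
    · rintro (h | ⟨i, hi, he, hm⟩)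
      · omega
      · rwa [le_antisymm (hmin i hi) (hm _ hfind)]
    · exact fun h => Or.inr ⟨_, hfind, h, hmin⟩
  rw [hD, ← Nat.even_add_one]
  constructor
  · rintro (h | ⟨i, hi, he, hm⟩)
    · omega
    · obtain ⟨i, rfl⟩ := Nat.exists_eq_add_of_le' hi.1
      have h1 := hmin i ((isAscent_insertLetter_last π i).1 hi)
      have h2 := hm _ ((isAscent_insertLetter_last π _).2 hfind)
      rwa [show Nat.find hex = i by omega]
  · refine fun h => Or.inr ⟨_, (isAscent_insertLetter_last π _).2 hfind, h, fun j hj => ?_⟩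
    obtain ⟨j, rfl⟩ := Nat.exists_eq_add_of_le' hj.1
    exact Nat.succ_le_succ (hmin j ((isAscent_insertLetter_last π j).1 hj))

lemma IsDesarrangement.one_lt_zero {n : ℕ} {π : Equiv.Perm (Fin (n + 2))}
    (h : IsDesarrangement (n + 2) π) : π 1 < π 0 := by
  rcases h with h | ⟨i, hi, he, hm⟩
  · omega
  · by_contra hc
    have hne : π 0 ≠ π 1 := π.injective.ne (by simp)
    have := hm 1 ⟨le_rfl, by omega, Or.inr ⟨by omega, lt_of_le_of_ne (not_lt.1 hc) hne⟩⟩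
    obtain rfl : i = 1 := le_antisymm this hi.1
    simp at he

lemma dcount_eq_card_filter_avoiders (n : ℕ) (σ : Fin 3 → Fin 3) :
    dcount n {![1, 0, 2], σ} = ((avoiders n σ).filter (IsDesarrangement n)).card := by
  unfold dcount avoiders
  rw [Finset.filter_filter]
  congr 1
  ext π
  simp [and_comm]

lemma dcount_add_two {n : ℕ} {σ : Fin 3 → Fin 3} (hσ : ∃ b, σ 0 < σ b) :
    dcount (n + 2) {![1, 0, 2], σ} + dcount (n + 1) {![1, 0, 2], σ} =
      (avoiders (n + 1) σ).card := by
  rw [dcount_eq_card_filter_avoiders, dcount_eq_card_filter_avoiders,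
    card_filter_avoiders_descent hσ _ fun _ h => h.one_lt_zero]
  simp only [isDesarrangement_insertLetter_last]
  rw [add_comm, Finset.card_filter_add_card_filter_not]

lemma dcount_one (σ : Fin 3 → Fin 3) : dcount 1 {![1, 0, 2], σ} = 0 := by
  rw [dcount, Finset.card_eq_zero, Finset.filter_eq_empty_iff]
  rintro π - ⟨h | ⟨i, hi, he, -⟩, -⟩
  · omega
  · obtain rfl : i = 1 := le_antisymm hi.2.1 hi.1
    simp at he

/-- For every integer `n ≥ 1` and each `σ ∈ {123, 132, 231}`, the number of
desarrangements of length `n` avoiding both 213 and `σ` equals the Jacobsthal number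
`J_(n−1)`, where `J₀ = 0`, `J₁ = 1`, and `J_n = J_(n−1) + 2·J_(n−2)` for `n ≥ 2`. -/
theorem desarrangements_avoiding_213_and_friend (J : ℕ → ℕ)
    (hJ0 : J 0 = 0) (hJ1 : J 1 = 1)
    (hJ : ∀ m : ℕ, J (m + 2) = J (m + 1) + 2 * J m)
    (n : ℕ) (hn : 1 ≤ n) (σ : Fin 3 → Fin 3)
    (hσ : σ = ![0,1,2] ∨ σ = ![0,2,1] ∨ σ = ![1,2,0]) :
    dcount n {![1,0,2], σ} = J (n - 1) := by
  have hdesc : ∃ b, σ 0 < σ b := by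
    rcases hσ with rfl | rfl | rfl
    · exact ⟨1, by decide⟩
    · exact ⟨1, by decide⟩
    · exact ⟨1, by decide⟩
  have hJsum : ∀ m, J (m + 1) + J m = 2 ^ m := by
    intro m
    induction m with
    | zero => simp [hJ0, hJ1]
    | succ m ih => rw [hJ, pow_succ]; omega
  obtain ⟨n, rfl⟩ := Nat.exists_eq_add_of_le' hn
  rw [Nat.add_sub_cancel]
  induction n with
  | zero => rw [hJ0]; exact dcount_one σ
  | succ n ih =>
    have h := dcount_add_two (n := n) hdesc
    rw [card_avoiders hσ, ih (by omega)] at h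
    exact Nat.add_right_cancel (h.trans (hJsum n).symm)
end

section
/- For every integer n ≥ 1 and each pattern σ ∈ {132, 231}, the number of desarrangements of length n avoiding both 312 and σ equals the Jacobsthal number J_{n−1}, i.e. d_n({312, σ}) = J_{n−1}. -/
open scoped Classical

/-- The word recording, for each pair of adjacent positions, whether `π` increases there. -/
noncomputable def ascentWord {k : ℕ} (π : Equiv.Perm (Fin (k + 1))) : Fin k → Bool :=
  fun i => decide (π i.castSucc < π i.succ)

/-- The number of leading `false` letters of a word. -/
def leadingFalses : {k : ℕ} → (Fin k → Bool) → ℕ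
  | 0, _ => 0
  | _ + 1, w => if w 0 then 0 else leadingFalses (Fin.tail w) + 1

lemma leadingFalses_le : ∀ {k : ℕ} (w : Fin k → Bool), leadingFalses w ≤ k
  | 0, _ => le_rfl
  | k + 1, w => by
    have := leadingFalses_le (Fin.tail w)
    rw [leadingFalses]
    split_ifs <;> omega

lemma apply_leadingFalses : ∀ {k : ℕ} (w : Fin k → Bool) (h : leadingFalses w < k),
    w ⟨leadingFalses w, h⟩ = true
  | 0, _, h => absurd h (Nat.not_lt_zero _)
  | k + 1, w, h => by
    by_cases hw : w 0 = true
    · have h0 : leadingFalses w = 0 := by simp [leadingFalses, hw]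
      simpa [h0] using hw
    · have h1 : leadingFalses w = leadingFalses (Fin.tail w) + 1 := by simp [leadingFalses, hw]
      have := apply_leadingFalses (Fin.tail w) (by omega)
      simpa [h1, Fin.tail] using this

lemma apply_of_lt_leadingFalses : ∀ {k : ℕ} (w : Fin k → Bool) (i : Fin k),
    (i : ℕ) < leadingFalses w → w i = false
  | 0, _, i, _ => i.elim0
  | k + 1, w, i, h => by
    by_cases hw : w 0 = true
    · simp [leadingFalses, hw] at h
    · have h1 : leadingFalses w = leadingFalses (Fin.tail w) + 1 := by simp [leadingFalses, hw]
      induction i using Fin.cases with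
      | zero => simpa using hw
      | succ i =>
        exact apply_of_lt_leadingFalses (Fin.tail w) i (by simp at h; omega)

lemma isAscent_succ_iff {k : ℕ} (π : Equiv.Perm (Fin (k + 1))) (i : ℕ) :
    IsAscent (k + 1) π (i + 1) ↔ i = k ∨ ∃ h : i < k, ascentWord π ⟨i, h⟩ = true := by
  constructor
  · rintro ⟨-, -, h | ⟨h, h'⟩⟩
    · left; omega
    · exact Or.inr ⟨by omega, by simpa [ascentWord] using h'⟩
  · rintro (h | ⟨h, h'⟩)
    · exact ⟨by omega, by omega, Or.inl (by omega)⟩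
    · exact ⟨by omega, by omega, Or.inr ⟨by omega, by simpa [ascentWord] using h'⟩⟩

lemma isDesarrangement_iff {k : ℕ} (π : Equiv.Perm (Fin (k + 1))) :
    IsDesarrangement (k + 1) π ↔ Odd (leadingFalses (ascentWord π)) := by
  set w := ascentWord π with hw
  have h1 : IsAscent (k + 1) π (leadingFalses w + 1) := by
    rw [isAscent_succ_iff]
    rcases (leadingFalses_le w).eq_or_lt with h | h
    · exact Or.inl h
    · exact Or.inr ⟨h, apply_leadingFalses w h⟩
  have h2 : ∀ j, IsAscent (k + 1) π j → leadingFalses w + 1 ≤ j := by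
    intro j hj
    obtain ⟨j, rfl⟩ : ∃ i, j = i + 1 := ⟨j - 1, by have := hj.1; omega⟩
    rw [isAscent_succ_iff] at hj
    rcases hj with rfl | ⟨h, hj⟩
    · have := leadingFalses_le w; omega
    · by_contra hlt
      have := apply_of_lt_leadingFalses w ⟨j, h⟩ (by simp; omega)
      simp_all
  constructor
  · rintro (h | ⟨i, hi, he, hmin⟩)
    · omega
    · have : i = leadingFalses w + 1 := le_antisymm (hmin _ h1) (h2 _ hi)
      subst this
      simpa [Nat.even_add_one] using he
  · intro ho
    exact Or.inr ⟨_, h1, by simpa [Nat.even_add_one] using ho, h2⟩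

/-- Exactly one of a word and its extension by a leading `false` has an odd number of leading
`false` letters. -/
lemma card_odd_leadingFalses_succ (k : ℕ) :
    (Finset.univ.filter fun w : Fin (k + 1) → Bool => Odd (leadingFalses w)).card
      + (Finset.univ.filter fun w : Fin k → Bool => Odd (leadingFalses w)).card = 2 ^ k := by
  have h : (Finset.univ.filter fun w : Fin (k + 1) → Bool => Odd (leadingFalses w)).card
      = (Finset.univ.filter fun w : Fin k → Bool => ¬ Odd (leadingFalses w)).card := by
    refine Finset.card_bij' (fun w _ => Fin.tail w)
      (fun w _ => (Fin.cons false w : Fin (k + 1) → Bool)) ?_ ?_ ?_ ?_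
    · intro w hw
      rw [Finset.mem_filter_univ] at hw ⊢
      by_cases h0 : w 0 = true <;> simp_all [leadingFalses, Nat.odd_add_one]
    · intro w hw
      rw [Finset.mem_filter_univ] at hw ⊢
      simpa [leadingFalses, Nat.odd_add_one] using hw
    · intro w hw
      rw [Finset.mem_filter_univ] at hw
      have h0 : w 0 = false := by
        by_contra h0
        simp_all [leadingFalses]
      rw [← h0]
      exact Fin.cons_self_tail w
    · intro w _
      exact Fin.tail_cons _ _
  rw [h, add_comm, Finset.card_filter_add_card_filter_not]
  simp

lemma card_odd_leadingFalses (J : ℕ → ℕ) (hJ0 : J 0 = 0) (hJ1 : J 1 = 1)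
    (hJ : ∀ m : ℕ, J (m + 2) = J (m + 1) + 2 * J m) (k : ℕ) :
    (Finset.univ.filter fun w : Fin k → Bool => Odd (leadingFalses w)).card = J k := by
  have hsum : ∀ m, J (m + 1) + J m = 2 ^ m := by
    intro m
    induction m with
    | zero => simp [hJ0, hJ1]
    | succ m ih => rw [hJ, pow_succ]; omega
  induction k with
  | zero => simp [leadingFalses, hJ0]
  | succ k ih =>
    have := card_odd_leadingFalses_succ k
    have := hsum k
    omega

/-- Every injective sequence in a linear order is order isomorphic to a permutation. -/
lemma exists_perm_lt_iff {n : ℕ} {α : Type*} [LinearOrder α] (f : Fin n → α)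
    (hf : Function.Injective f) :
    ∃ π : Equiv.Perm (Fin n), ∀ i j, π i < π j ↔ f i < f j := by
  have hs : StrictMono (f ∘ Tuple.sort f) :=
    (Tuple.monotone_sort f).strictMono_of_injective (hf.comp (Tuple.sort f).injective)
  refine ⟨(Tuple.sort f)⁻¹, fun i j => ?_⟩
  rw [← hs.lt_iff_lt]
  simp

lemma perm_eq_of_lt_iff {n : ℕ} (π ρ : Equiv.Perm (Fin n))
    (h : ∀ i j, i < j → (π i < π j ↔ ρ i < ρ j)) : π = ρ := by
  have h' : ∀ i j, π i < π j ↔ ρ i < ρ j := by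
    intro i j
    rcases lt_trichotomy i j with hij | rfl | hij
    · exact h i j hij
    · simp
    · have h1 := h j i hij
      have h2 : π i ≠ π j := fun e => hij.ne' (π.injective e)
      have h3 : ρ i ≠ ρ j := fun e => hij.ne' (ρ.injective e)
      rw [← not_iff_not, not_lt, not_lt, le_iff_lt_or_eq, le_iff_lt_or_eq, h1]
      simp [h2.symm, h3.symm]
  have hm : StrictMono (π * ρ⁻¹) := by
    intro a b hab
    simpa [h'] using hab
  have : ∀ a, (π * ρ⁻¹) a = a := fun a => by
    have := hm.range_inj (strictMono_id (α := Fin n))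
    simp at this
    exact congrFun this a
  ext i
  simpa using congrArg Fin.val (this (ρ i))

/-- If membership in a class of permutations means that the relative order of any two entries is
prescribed by the ascent word, and every word occurs, then the desarrangements in the class are
counted by the words with an odd number of leading `false` letters. -/
lemma card_desarrangement_of_ascentWord {k : ℕ} (C : Equiv.Perm (Fin (k + 1)) → Prop)
    [DecidablePred C]
    (Q : (Fin k → Bool) → Fin (k + 1) → Fin (k + 1) → Prop)
    (hC : ∀ π, C π ↔ ∀ i j, i < j → (π i < π j ↔ Q (ascentWord π) i j))
    (hQ : ∀ w (i : Fin k), Q w i.castSucc i.succ ↔ w i = true)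
    (hex : ∀ w, ∃ π : Equiv.Perm (Fin (k + 1)), ∀ i j, i < j → (π i < π j ↔ Q w i j)) :
    (Finset.univ.filter fun π => IsDesarrangement (k + 1) π ∧ C π).card
      = (Finset.univ.filter fun w : Fin k → Bool => Odd (leadingFalses w)).card := by
  refine Finset.card_bij (fun π _ => ascentWord π) ?_ ?_ ?_
  · intro π hπ
    simpa [isDesarrangement_iff] using (Finset.mem_filter.mp hπ).2.1
  · intro π hπ ρ hρ h
    have h1 := (hC π).mp (Finset.mem_filter.mp hπ).2.2
    have h2 := (hC ρ).mp (Finset.mem_filter.mp hρ).2.2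
    refine perm_eq_of_lt_iff π ρ fun i j hij => ?_
    rw [h1 i j hij, h2 i j hij]
    exact iff_of_eq (congrArg (Q · i j) h)
  · intro w hw
    obtain ⟨π, hπ⟩ := hex w
    have hword : ascentWord π = w := by
      funext i
      rw [Bool.eq_iff_iff, ← hQ w i, ← hπ _ _ i.castSucc_lt_succ, ascentWord, decide_eq_true_iff]
    refine ⟨π, ?_, hword⟩
    rw [Finset.mem_filter, isDesarrangement_iff, hC, hword]
    exact ⟨Finset.mem_univ _, (Finset.mem_filter.mp hw).2, hπ⟩

lemma containsPattern_three_iff {n : ℕ} (σ : Fin 3 → Fin 3) (π : Equiv.Perm (Fin n)) :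
    ContainsPattern σ π ↔ ∃ a b c : Fin n, a < b ∧ b < c ∧
      ∀ x y : Fin 3, π (![a, b, c] x) < π (![a, b, c] y) ↔ σ x < σ y := by
  constructor
  · rintro ⟨f, hf⟩
    refine ⟨f 0, f 1, f 2, f.strictMono (by decide), f.strictMono (by decide), fun x y => ?_⟩
    rw [← hf]
    fin_cases x <;> fin_cases y <;> rfl
  · rintro ⟨a, b, c, hab, hbc, h⟩
    refine ⟨OrderEmbedding.ofStrictMono ![a, b, c] ?_, h⟩
    intro x y hxy
    have := hab.trans hbc
    fin_cases x <;> fin_cases y <;> simp_all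

lemma containsPattern_312_iff {n : ℕ} (π : Equiv.Perm (Fin n)) :
    ContainsPattern ![2, 0, 1] π ↔ ∃ a b c, a < b ∧ b < c ∧ π b < π c ∧ π c < π a := by
  rw [containsPattern_three_iff]
  simp only [Fin.forall_fin_succ]
  constructor
  · rintro ⟨a, b, c, hab, hbc, h⟩
    exact ⟨a, b, c, hab, hbc, by simp at h; grind, by simp at h; grind⟩
  · rintro ⟨a, b, c, hab, hbc, h1, h2⟩
    exact ⟨a, b, c, hab, hbc, by simp; grind⟩

lemma containsPattern_132_iff {n : ℕ} (π : Equiv.Perm (Fin n)) :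
    ContainsPattern ![0, 2, 1] π ↔ ∃ a b c, a < b ∧ b < c ∧ π a < π c ∧ π c < π b := by
  rw [containsPattern_three_iff]
  simp only [Fin.forall_fin_succ]
  constructor
  · rintro ⟨a, b, c, hab, hbc, h⟩
    exact ⟨a, b, c, hab, hbc, by simp at h; grind, by simp at h; grind⟩
  · rintro ⟨a, b, c, hab, hbc, h1, h2⟩
    exact ⟨a, b, c, hab, hbc, by simp; grind⟩

lemma containsPattern_231_iff {n : ℕ} (π : Equiv.Perm (Fin n)) :
    ContainsPattern ![1, 2, 0] π ↔ ∃ a b c, a < b ∧ b < c ∧ π c < π a ∧ π a < π b := by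
  rw [containsPattern_three_iff]
  simp only [Fin.forall_fin_succ]
  constructor
  · rintro ⟨a, b, c, hab, hbc, h⟩
    exact ⟨a, b, c, hab, hbc, by simp at h; grind, by simp at h; grind⟩
  · rintro ⟨a, b, c, hab, hbc, h1, h2⟩
    exact ⟨a, b, c, hab, hbc, by simp; grind⟩

/-- A permutation avoids 312 and 132 iff each entry compares with all earlier ones as it does with
its predecessor. -/
lemma avoids_312_132_iff {k : ℕ} (π : Equiv.Perm (Fin (k + 1))) :
    (¬ ContainsPattern ![2, 0, 1] π ∧ ¬ ContainsPattern ![0, 2, 1] π) ↔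
      ∀ i j, i < j → (π i < π j ↔ ∃ m : Fin k, m.succ = j ∧ ascentWord π m = true) := by
  rw [containsPattern_312_iff, containsPattern_132_iff]
  constructor
  · rintro ⟨h1, h2⟩ i j hij
    obtain ⟨m, rfl⟩ := Fin.exists_succ_eq.mpr (Fin.ne_zero_of_lt hij)
    simp only [Fin.succ_inj, exists_eq_left, ascentWord, decide_eq_true_iff]
    rcases (Fin.le_castSucc_iff.mpr hij).eq_or_lt with rfl | him
    · rfl
    · have hm := m.castSucc_lt_succ
      have e1 := π.injective.ne hij.ne
      have e2 := π.injective.ne hm.ne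
      push Not at h1 h2
      have h1 := h1 i _ _ him hm
      have h2 := h2 i _ _ him hm
      grind
  · intro h
    constructor
    · rintro ⟨a, b, c, hab, hbc, h1, h2⟩
      exact h2.not_gt ((h a c (hab.trans hbc)).mpr ((h b c hbc).mp h1))
    · rintro ⟨a, b, c, hab, hbc, h1, h2⟩
      exact h2.not_gt ((h b c hbc).mpr ((h a c (hab.trans hbc)).mp h1))

/-- A permutation avoids 312 and 231 iff any two entries with an ascent between them are in
increasing order. -/
lemma avoids_312_231_iff {k : ℕ} (π : Equiv.Perm (Fin (k + 1))) :
    (¬ ContainsPattern ![2, 0, 1] π ∧ ¬ ContainsPattern ![1, 2, 0] π) ↔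
      ∀ i j, i < j →
        (π i < π j ↔ ∃ m : Fin k, i ≤ m.castSucc ∧ m.succ ≤ j ∧ ascentWord π m = true) := by
  rw [containsPattern_312_iff, containsPattern_231_iff]
  constructor
  · rintro ⟨h1, h2⟩ i j hij
    push Not at h1 h2
    constructor
    · intro hlt
      by_contra! hno
      have key : ∀ j, i ≤ j → (∀ m : Fin k, i ≤ m.castSucc → m.succ ≤ j →
          ascentWord π m ≠ true) → π j ≤ π i := by
        intro j
        induction j using Fin.induction with
        | zero => intro h _; rw [Fin.le_zero_iff.mp h]
        | succ m ih =>
          intro hi hm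
          rcases hi.eq_or_lt with rfl | hi
          · rfl
          · have hi := Fin.le_castSucc_iff.mpr hi
            have hdesc := hm m hi le_rfl
            simp only [ascentWord, ne_eq, decide_eq_true_iff, not_lt] at hdesc
            exact hdesc.trans (ih hi fun m' h h' =>
              hm m' h (h'.trans m.castSucc_lt_succ.le))
      exact (key j hij.le hno).not_gt hlt
    · rintro ⟨m, him, hmj, hm⟩
      simp only [ascentWord, decide_eq_true_iff] at hm
      have hms := m.castSucc_lt_succ
      have h3 : π i < π m.succ := by
        rcases him.eq_or_lt with rfl | him
        · exact hm
        · exact (h1 _ _ _ him hms hm).lt_of_ne (π.injective.ne (him.trans hms).ne)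
      rcases hmj.eq_or_lt with rfl | hmj
      · exact h3
      · by_contra hji
        have := π.injective.ne hij.ne
        exact (h2 i _ j (him.trans_lt hms) hmj (by grind)).not_gt h3
  · intro h
    constructor
    · rintro ⟨a, b, c, hab, hbc, h1, h2⟩
      obtain ⟨m, hm, hm'⟩ := (h b c hbc).mp h1
      exact h2.not_gt ((h a c (hab.trans hbc)).mpr ⟨m, hab.le.trans hm, hm'⟩)
    · rintro ⟨a, b, c, hab, hbc, h1, h2⟩
      obtain ⟨m, hm, hm', hw⟩ := (h a b hab).mp h2
      exact h1.not_gt ((h a c (hab.trans hbc)).mpr ⟨m, hm, hm'.trans hbc.le, hw⟩)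

lemma exists_perm_lt_iff_last_step {k : ℕ} (w : Fin k → Bool) :
    ∃ π : Equiv.Perm (Fin (k + 1)), ∀ i j, i < j →
      (π i < π j ↔ ∃ m : Fin k, m.succ = j ∧ w m = true) := by
  let f : Fin (k + 1) → ℤ :=
    Fin.cons 0 fun m => if w m = true then (m : ℤ) + 1 else -((m : ℤ) + 1)
  have habs : ∀ i, |f i| = (i : ℕ) := by
    intro i
    induction i using Fin.cases with
    | zero => simp [f]
    | succ m =>
      have hm : |(m : ℤ) + 1| = m + 1 := abs_of_nonneg (by positivity)
      simp only [f, Fin.cons_succ]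
      split_ifs
      · simpa using hm
      · rw [abs_neg]; simpa using hm
  obtain ⟨π, hπ⟩ := exists_perm_lt_iff f fun i j h => by
    have := habs i
    rw [h, habs j] at this
    exact Fin.ext (by exact_mod_cast this.symm)
  refine ⟨π, fun i j hij => ?_⟩
  obtain ⟨m, rfl⟩ := Fin.exists_succ_eq.mpr (Fin.ne_zero_of_lt hij)
  simp only [Fin.succ_inj, exists_eq_left]
  rw [hπ]
  have h1 : |f i| < m + 1 := by
    rw [habs]
    have : (i : ℕ) < m + 1 := by simpa [Fin.lt_def] using hij
    exact_mod_cast this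
  have h2 := abs_lt.mp h1
  have h3 : f m.succ = if w m = true then (m : ℤ) + 1 else -((m : ℤ) + 1) := by simp [f]
  rw [h3]
  split_ifs with hw
  · simp [hw, h2.2]
  · simpa [hw] using h2.1.le

lemma exists_perm_lt_iff_some_step {k : ℕ} (w : Fin k → Bool) :
    ∃ π : Equiv.Perm (Fin (k + 1)), ∀ i j, i < j →
      (π i < π j ↔ ∃ m : Fin k, i ≤ m.castSucc ∧ m.succ ≤ j ∧ w m = true) := by
  let s : Fin (k + 1) → Finset (Fin k) := fun j =>
    Finset.univ.filter fun m => m.succ ≤ j ∧ w m = true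
  let f : Fin (k + 1) → ℕ ×ₗ (Fin (k + 1))ᵒᵈ := fun j => toLex ((s j).card, OrderDual.toDual j)
  obtain ⟨π, hπ⟩ := exists_perm_lt_iff f fun i j h => by
    simpa [f] using congrArg (fun p => (ofLex p).2) h
  refine ⟨π, fun i j hij => ?_⟩
  have hsub : s i ⊆ s j := fun m hm => by
    simp only [s, Finset.mem_filter, Finset.mem_univ, true_and] at hm ⊢
    exact ⟨hm.1.trans hij.le, hm.2⟩
  have hlt : π i < π j ↔ (s i).card < (s j).card := by
    rw [hπ, Prod.Lex.lt_iff]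
    simp [f, hij.not_gt]
  rw [hlt]
  constructor
  · intro h
    obtain ⟨m, hm, hm'⟩ := Finset.exists_mem_notMem_of_card_lt_card h
    simp only [s, Finset.mem_filter, Finset.mem_univ, true_and] at hm hm'
    exact ⟨m, Fin.le_castSucc_iff.mpr (by grind), hm⟩
  · rintro ⟨m, him, hm⟩
    refine Finset.card_lt_card (Finset.ssubset_iff_of_subset hsub |>.mpr ⟨m, ?_, ?_⟩)
    · simpa [s] using hm
    · have := Fin.le_castSucc_iff.mp him
      simp [s, this]

/-- For every integer `n ≥ 1` and each `σ ∈ {132, 231}`, the number of desarrangements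
of length `n` avoiding both 312 and `σ` equals the Jacobsthal number `J_(n−1)`, where
`J₀ = 0`, `J₁ = 1`, and `J_n = J_(n−1) + 2·J_(n−2)` for `n ≥ 2`. -/
theorem desarrangements_avoiding_312_and_friend (J : ℕ → ℕ)
    (hJ0 : J 0 = 0) (hJ1 : J 1 = 1)
    (hJ : ∀ m : ℕ, J (m + 2) = J (m + 1) + 2 * J m)
    (n : ℕ) (hn : 1 ≤ n) (σ : Fin 3 → Fin 3)
    (hσ : σ = ![0,2,1] ∨ σ = ![1,2,0]) :
    dcount n {![2,0,1], σ} = J (n - 1) := by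
  obtain ⟨k, rfl⟩ : ∃ k, n = k + 1 := ⟨n - 1, by omega⟩
  rw [Nat.add_sub_cancel, ← card_odd_leadingFalses J hJ0 hJ1 hJ k, dcount]
  have hfilter : (Finset.univ.filter fun π : Equiv.Perm (Fin (k + 1)) =>
      IsDesarrangement (k + 1) π ∧ ∀ τ ∈ ({![2, 0, 1], σ} : Finset _), ¬ ContainsPattern τ π)
      = Finset.univ.filter fun π => IsDesarrangement (k + 1) π ∧
        (¬ ContainsPattern ![2, 0, 1] π ∧ ¬ ContainsPattern σ π) :=
    Finset.filter_congr fun π _ => by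
      rw [Finset.forall_mem_insert]
      simp only [Finset.mem_singleton, forall_eq]
  rw [hfilter]
  rcases hσ with rfl | rfl
  · exact card_desarrangement_of_ascentWord
      (fun π => ¬ ContainsPattern ![2, 0, 1] π ∧ ¬ ContainsPattern ![0, 2, 1] π)
      (fun w _ j => ∃ m : Fin k, m.succ = j ∧ w m = true) avoids_312_132_iff
      (fun w i => by simp) exists_perm_lt_iff_last_step
  · refine card_desarrangement_of_ascentWord
      (fun π => ¬ ContainsPattern ![2, 0, 1] π ∧ ¬ ContainsPattern ![1, 2, 0] π)
      (fun w i j => ∃ m : Fin k, i ≤ m.castSucc ∧ m.succ ≤ j ∧ w m = true) avoids_312_231_iff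
      (fun w i => ⟨?_, fun h => ⟨i, le_rfl, le_rfl, h⟩⟩) exists_perm_lt_iff_some_step
    rintro ⟨m, h1, h2, h3⟩
    obtain rfl : i = m := le_antisymm (by simpa using h1) (by simpa using h2)
    exact h3
end

section
/- For every integer n ≥ 0, the number of desarrangements of length n avoiding both patterns 123 and 132 satisfies 9·d_n({123, 132}) = 2^{n+1} + (7 − 3n)·(−1)^n. -/
open scoped Classical

/-- Every letter of `π` has at most one larger letter to its right. -/
def AtMostOneLargerRight {n : ℕ} (π : Equiv.Perm (Fin n)) : Prop :=
  ∀ i j k, i < j → j < k → ¬ (π i < π j ∧ π i < π k)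

theorem containsPattern_of_lt {n : ℕ} {σ : Fin 3 → Fin 3} {π : Equiv.Perm (Fin n)}
    {i j k : Fin n} (hij : i < j) (hjk : j < k)
    (h : ∀ a b : Fin 3, π (![i, j, k] a) < π (![i, j, k] b) ↔ σ a < σ b) :
    ContainsPattern σ π := by
  refine ⟨OrderEmbedding.ofStrictMono ![i, j, k] ?_, h⟩
  intro a b hab
  fin_cases a <;> fin_cases b <;> simp_all
  exact hij.trans hjk

theorem avoids_123_132_iff {n : ℕ} (π : Equiv.Perm (Fin n)) :
    (∀ σ ∈ ({![0,1,2], ![0,2,1]} : Finset (Fin 3 → Fin 3)), ¬ ContainsPattern σ π) ↔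
      AtMostOneLargerRight π := by
  simp only [Finset.mem_insert, Finset.mem_singleton, forall_eq_or_imp, forall_eq]
  constructor
  · rintro ⟨h₁, h₂⟩ i j k hij hjk ⟨hj, hk⟩
    rcases lt_trichotomy (π j) (π k) with hlt | heq | hgt
    · refine h₁ (containsPattern_of_lt hij hjk ?_)
      intro a b
      fin_cases a <;> fin_cases b <;> simp [hj, hk, hlt, hj.le, hk.le, hlt.le]
    · exact hjk.ne (π.injective heq)
    · refine h₂ (containsPattern_of_lt hij hjk ?_)
      intro a b
      fin_cases a <;> fin_cases b <;> simp [hj, hk, hgt, hj.le, hk.le, hgt.le]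
  · intro h
    constructor <;> rintro ⟨f, hf⟩ <;>
      exact h (f 0) (f 1) (f 2) (f.strictMono (by decide)) (f.strictMono (by decide))
        ⟨(hf 0 1).2 (by decide), (hf 0 2).2 (by decide)⟩

/-- The permutation with first letter `p` whose remaining letters are ordered like `σ`. -/
def consPerm {n : ℕ} (p : Fin (n + 1)) (σ : Equiv.Perm (Fin n)) : Equiv.Perm (Fin (n + 1)) :=
  (finSuccEquiv' 0).trans ((Equiv.optionCongr σ).trans (finSuccEquiv' p).symm)

@[simp] theorem consPerm_zero {n : ℕ} (p : Fin (n + 1)) (σ : Equiv.Perm (Fin n)) :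
    consPerm p σ 0 = p := by
  simp [consPerm]

@[simp] theorem consPerm_succ {n : ℕ} (p : Fin (n + 1)) (σ : Equiv.Perm (Fin n)) (i : Fin n) :
    consPerm p σ i.succ = p.succAbove (σ i) := by
  have h : finSuccEquiv' (0 : Fin (n + 1)) i.succ = some i := by
    rw [← Fin.succAbove_zero_apply, finSuccEquiv'_succAbove]
  simp [consPerm, h]

theorem consPerm_bijective (n : ℕ) :
    Function.Bijective fun x : Fin (n + 1) × Equiv.Perm (Fin n) => consPerm x.1 x.2 := by
  rw [Fintype.bijective_iff_injective_and_card]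
  constructor
  · rintro ⟨p, σ⟩ ⟨q, τ⟩ h
    have hpq : p = q := by simpa using DFunLike.congr_fun h 0
    subst hpq
    have hστ : σ = τ := by
      ext i
      have := DFunLike.congr_fun h i.succ
      simp only [consPerm_succ, Fin.succAbove_right_inj] at this
      rw [this]
    rw [hστ]
  · simp [Fintype.card_perm, Nat.factorial_succ]

theorem atMostOneLargerRight_consPerm {n : ℕ} (p : Fin (n + 1)) (σ : Equiv.Perm (Fin n)) :
    AtMostOneLargerRight (consPerm p σ) ↔ AtMostOneLargerRight σ ∧ n ≤ p + 1 := by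
  constructor
  · intro h
    refine ⟨fun i j k hij hjk hlt => h i.succ j.succ k.succ (by simpa) (by simpa) (by simpa), ?_⟩
    by_contra! hp
    have key : ∀ i j, i < j → ¬ ((p : ℕ) ≤ σ i ∧ (p : ℕ) ≤ σ j) := by
      intro i j hij hle
      refine h 0 i.succ j.succ (Fin.succ_pos i) (by simpa) ?_
      simpa [Fin.lt_succAbove_iff_le_castSucc, Fin.le_def] using hle
    have hne : σ.symm ⟨n - 1, by omega⟩ ≠ σ.symm ⟨n - 2, by omega⟩ := by
      simp [Fin.ext_iff]; omega
    rcases lt_or_gt_of_ne hne with hlt | hlt <;>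
    · refine key _ _ hlt ?_
      simp only [Equiv.apply_symm_apply]
      omega
  · rintro ⟨h, hp⟩ i j k hij hjk
    obtain ⟨j, rfl⟩ := Fin.exists_succ_eq.2 (Fin.ne_zero_of_lt hij)
    obtain ⟨k, rfl⟩ := Fin.exists_succ_eq.2 (Fin.ne_zero_of_lt hjk)
    have hjk' : j < k := by simpa using hjk
    refine Fin.cases (fun _ => ?_) (fun i hij => ?_) i hij
    · simp only [consPerm_zero, consPerm_succ, Fin.lt_succAbove_iff_le_castSucc, Fin.le_def,
        Fin.val_castSucc]
      rintro ⟨hj, hk⟩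
      exact hjk'.ne (σ.injective (Fin.ext (by omega)))
    · simpa using h i j k (by simpa using hij) hjk'

theorem isAscent_consPerm_one {n : ℕ} (p : Fin (n + 2)) (σ : Equiv.Perm (Fin (n + 1))) :
    IsAscent (n + 2) (consPerm p σ) 1 ↔ (p : ℕ) ≤ σ 0 := by
  have h₁ : consPerm p σ 1 = p.succAbove (σ 0) := consPerm_succ p σ 0
  simp [IsAscent, h₁, Fin.lt_succAbove_iff_le_castSucc, Fin.le_def]

theorem isAscent_consPerm_succ {n : ℕ} (p : Fin (n + 2)) (σ : Equiv.Perm (Fin (n + 1)))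
    {i : ℕ} (hi : 1 ≤ i) :
    IsAscent (n + 2) (consPerm p σ) (i + 1) ↔ IsAscent (n + 1) σ i := by
  obtain ⟨i, rfl⟩ := Nat.exists_eq_add_of_le' hi
  have h (j : ℕ) (hj : j < n + 1) :
      consPerm p σ ⟨j + 1, by omega⟩ = p.succAbove (σ ⟨j, hj⟩) := consPerm_succ p σ ⟨j, hj⟩
  constructor
  · rintro ⟨-, hle, heq | ⟨hlt, has⟩⟩
    · exact ⟨by omega, by omega, Or.inl (by omega)⟩
    · refine ⟨by omega, by omega, Or.inr ⟨by omega, ?_⟩⟩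
      have has' : consPerm p σ ⟨i + 1, by omega⟩ < consPerm p σ ⟨i + 1 + 1, by omega⟩ := has
      rw [h i (by omega), h (i + 1) (by omega)] at has'
      simpa using has'
  · rintro ⟨-, hle, heq | ⟨hlt, has⟩⟩
    · exact ⟨by omega, by omega, Or.inl (by omega)⟩
    · refine ⟨by omega, by omega, Or.inr ⟨by omega, ?_⟩⟩
      change consPerm p σ ⟨i + 1, by omega⟩ < consPerm p σ ⟨i + 1 + 1, by omega⟩
      rw [h i (by omega), h (i + 1) (by omega)]
      simpa using has

theorem exists_first_ascent {n : ℕ} (π : Equiv.Perm (Fin (n + 1))) :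
    ∃ i, IsAscent (n + 1) π i ∧ ∀ j, IsAscent (n + 1) π j → i ≤ j := by
  have h : ∃ i, IsAscent (n + 1) π i := ⟨n + 1, by omega, le_rfl, Or.inl rfl⟩
  exact ⟨Nat.find h, Nat.find_spec h, fun j hj => Nat.find_min' h hj⟩

theorem isDesarrangement_iff_even {n i : ℕ} {π : Equiv.Perm (Fin (n + 1))}
    (hi : IsAscent (n + 1) π i) (hmin : ∀ j, IsAscent (n + 1) π j → i ≤ j) :
    IsDesarrangement (n + 1) π ↔ Even i := by
  constructor
  · rintro (h | ⟨j, hj, heven, hjmin⟩)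
    · omega
    · rwa [le_antisymm (hmin j hj) (hjmin i hi)]
  · exact fun h => Or.inr ⟨i, hi, h, hmin⟩

theorem isDesarrangement_consPerm {n : ℕ} (p : Fin (n + 2)) (σ : Equiv.Perm (Fin (n + 1))) :
    IsDesarrangement (n + 2) (consPerm p σ) ↔
      (σ 0 : ℕ) < p ∧ ¬ IsDesarrangement (n + 1) σ := by
  by_cases hp : (p : ℕ) ≤ σ 0
  · rw [isDesarrangement_iff_even ((isAscent_consPerm_one p σ).2 hp) fun j hj => hj.1]
    simp [hp]
  · obtain ⟨i, hi, hmin⟩ := exists_first_ascent σ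
    rw [isDesarrangement_iff_even hi hmin,
      isDesarrangement_iff_even ((isAscent_consPerm_succ p σ hi.1).2 hi), Nat.even_add_one]
    · simp [not_le.1 hp]
    · intro j hj
      obtain ⟨j, rfl⟩ := Nat.exists_eq_add_of_le' hj.1
      rcases Nat.eq_zero_or_pos j with rfl | hpos
      · exact absurd ((isAscent_consPerm_one p σ).1 hj) hp
      · exact Nat.succ_le_succ (hmin j ((isAscent_consPerm_succ p σ hpos).1 hj))

/-- The number of permutations satisfying `Q` in which every letter has at most one larger
letter to its right. -/
noncomputable def countWith {n : ℕ} (Q : Equiv.Perm (Fin n) → Prop) : ℤ :=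
  ∑ π : Equiv.Perm (Fin n), if AtMostOneLargerRight π ∧ Q π then 1 else 0

theorem countWith_succ {n : ℕ} (Q : Equiv.Perm (Fin (n + 2)) → Prop) :
    countWith Q = countWith (fun σ => Q (consPerm (Fin.last n).castSucc σ)) +
      countWith (fun σ => Q (consPerm (Fin.last (n + 1)) σ)) := by
  unfold countWith
  rw [← (consPerm_bijective (n + 1)).sum_comp, Fintype.sum_prod_type, Fin.sum_univ_castSucc,
    Fin.sum_univ_castSucc, Finset.sum_eq_zero, zero_add]
  · simp [atMostOneLargerRight_consPerm]
  · intro p _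
    refine Finset.sum_eq_zero fun σ _ => if_neg ?_
    rw [atMostOneLargerRight_consPerm]
    simp only [Fin.val_castSucc]
    omega

theorem countWith_and_not {n : ℕ} (Q R : Equiv.Perm (Fin n) → Prop) :
    countWith (fun π => Q π ∧ ¬ R π) = countWith Q - countWith fun π => Q π ∧ R π := by
  unfold countWith
  rw [← Finset.sum_sub_distrib]
  refine Finset.sum_congr rfl fun π _ => ?_
  by_cases hA : AtMostOneLargerRight π <;> by_cases hQ : Q π <;> by_cases hR : R π <;>
    simp [hA, hQ, hR]

theorem countWith_false {n : ℕ} : countWith (fun _ : Equiv.Perm (Fin n) => False) = 0 := by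
  simp [countWith]

theorem countWith_true_succ (n : ℕ) :
    countWith (fun _ : Equiv.Perm (Fin (n + 2)) => True) =
      2 * countWith (fun _ : Equiv.Perm (Fin (n + 1)) => True) := by
  rw [countWith_succ, two_mul]

theorem countWith_first_lt_succ (n : ℕ) :
    countWith (fun π : Equiv.Perm (Fin (n + 2)) => (π 0 : ℕ) < n + 1) =
      countWith (fun _ : Equiv.Perm (Fin (n + 1)) => True) := by
  rw [countWith_succ]
  simp [countWith_false]

theorem countWith_isDesarrangement_succ (n : ℕ) :
    countWith (IsDesarrangement (n + 2)) =
      countWith (fun σ : Equiv.Perm (Fin (n + 1)) => (σ 0 : ℕ) < n)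
        - countWith (fun σ => (σ 0 : ℕ) < n ∧ IsDesarrangement (n + 1) σ)
        + (countWith (fun _ : Equiv.Perm (Fin (n + 1)) => True)
        - countWith (IsDesarrangement (n + 1))) := by
  rw [countWith_succ]
  have h := countWith_and_not (fun _ => True) (IsDesarrangement (n + 1))
  simp only [true_and] at h
  simp [isDesarrangement_consPerm, ← h, ← countWith_and_not, Fin.is_le]

theorem countWith_first_lt_isDesarrangement_succ (n : ℕ) :
    countWith (fun π => (π 0 : ℕ) < n + 1 ∧ IsDesarrangement (n + 2) π) =
      countWith (fun σ : Equiv.Perm (Fin (n + 1)) => (σ 0 : ℕ) < n)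
        - countWith (fun σ => (σ 0 : ℕ) < n ∧ IsDesarrangement (n + 1) σ) := by
  rw [countWith_succ]
  simp [isDesarrangement_consPerm, ← countWith_and_not, countWith_false]

theorem countWith_true (n : ℕ) :
    countWith (fun _ : Equiv.Perm (Fin (n + 1)) => True) = 2 ^ n := by
  induction n with
  | zero =>
    simp [countWith, AtMostOneLargerRight]
  | succ n ih => rw [countWith_true_succ, ih, pow_succ']

theorem not_isDesarrangement_one (π : Equiv.Perm (Fin 1)) : ¬ IsDesarrangement 1 π := by
  rw [isDesarrangement_iff_even (i := 1) ⟨le_rfl, le_rfl, Or.inl rfl⟩ fun j hj => hj.1]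
  decide

theorem three_mul_countWith_first_lt_isDesarrangement (n : ℕ) :
    3 * countWith (fun π => (π 0 : ℕ) < n + 1 ∧ IsDesarrangement (n + 2) π) =
      2 ^ n - (-1) ^ n := by
  induction n with
  | zero =>
    rw [countWith_first_lt_isDesarrangement_succ]
    simp [countWith_false]
  | succ n ih =>
    rw [countWith_first_lt_isDesarrangement_succ, countWith_first_lt_succ, countWith_true]
    linear_combination -ih

theorem nine_mul_countWith_isDesarrangement (n : ℕ) :
    9 * countWith (IsDesarrangement (n + 2)) = 2 ^ (n + 3) + (1 - 3 * (n : ℤ)) * (-1) ^ n := by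
  induction n with
  | zero =>
    have h : IsDesarrangement 1 = fun _ => False :=
      funext fun π => eq_false (not_isDesarrangement_one π)
    rw [countWith_isDesarrangement_succ, countWith_true]
    simp [countWith_false, h]
  | succ n ih =>
    rw [countWith_isDesarrangement_succ, countWith_first_lt_succ, countWith_true, countWith_true]
    push_cast
    linear_combination -ih - 3 * three_mul_countWith_first_lt_isDesarrangement n

theorem dcount_eq_countWith (n : ℕ) :
    (dcount n {![0,1,2], ![0,2,1]} : ℤ) = countWith (IsDesarrangement n) := by
  unfold dcount countWith
  rw [Finset.card_filter]
  push_cast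
  simp only [avoids_123_132_iff, and_comm]

/-- For every integer `n ≥ 0`, `9·d_n({123, 132}) = 2^(n+1) + (7 − 3n)·(−1)^n`. -/
theorem desarrangements_avoiding_123_132 (n : ℕ) :
    (9 : ℤ) * dcount n {![0,1,2], ![0,2,1]} =
      2 ^ (n + 1) + (7 - 3 * (n : ℤ)) * (-1) ^ n := by
  rw [dcount_eq_countWith]
  match n with
  | 0 => simp [countWith, AtMostOneLargerRight, IsDesarrangement]
  | 1 => simp [countWith, not_isDesarrangement_one]
  | n + 2 =>
    rw [nine_mul_countWith_isDesarrangement]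
    push_cast
    ring
end

section
/- For every integer n ≥ 0, the number of desarrangements of length n avoiding both patterns 123 and 231 satisfies 8·d_n({123, 231}) = 2n(n − 1) + (5 − 2n)·(−1)^n + 3. -/
open scoped Classical

/-- The `j`-th letter of the word `n-1, …, n-m, i-m-1, …, 0, n-m-1, …, i-m` of length `n`, in
which the second decreasing block ends just before position `i`. -/
def blockWord (n m i j : ℕ) : ℕ :=
  if j < m then n - 1 - j else if j < i then i - 1 - j else n - 1 - (j - (i - m))

lemma blockWord_lt {n m i j : ℕ} (hi : i ≤ n) (hj : j < n) : blockWord n m i j < n := by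
  unfold blockWord; split_ifs <;> omega

lemma blockWord_inj {n m i j k : ℕ} (hm : m ≤ i) (hi : i ≤ n) (hj : j < n) (hk : k < n)
    (h : blockWord n m i j = blockWord n m i k) : j = k := by
  unfold blockWord at h; split_ifs at h <;> omega

/-- The permutation whose one-line notation is `blockWord n m i`. -/
noncomputable def blockPerm (n m i : ℕ) (hm : m ≤ i) (hi : i ≤ n) : Equiv.Perm (Fin n) :=
  Equiv.ofBijective (fun j => ⟨blockWord n m i j, blockWord_lt hi j.2⟩)
    (Finite.injective_iff_bijective.mp fun j k h =>
      Fin.ext (blockWord_inj hm hi j.2 k.2 (congrArg Fin.val h)))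

lemma blockPerm_val {n m i : ℕ} (hm : m ≤ i) (hi : i ≤ n) (j : Fin n) :
    (blockPerm n m i hm hi j : ℕ) = blockWord n m i j := rfl

lemma Equiv.Perm.eq_of_lt_imp_lt {n : ℕ} {π σ : Equiv.Perm (Fin n)}
    (h : ∀ a b, σ a < σ b → π a < π b) : σ = π := by
  have hmono : StrictMono (σ.symm.trans π) := fun a b hab => by
    simpa using h (σ.symm a) (σ.symm b) (by simpa using hab)
  have hid : (σ.symm.trans π : Fin n → Fin n) = id :=
    (hmono.range_inj strictMono_id).1 (by simp)
  ext a
  simpa using (congrArg Fin.val (congrFun hid (σ a))).symm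

lemma containsPattern_three {n : ℕ} {π : Equiv.Perm (Fin n)} {σ : Fin 3 → Fin 3} :
    ContainsPattern σ π ↔ ∃ a b c : Fin n, a < b ∧ b < c ∧
      ∀ x y : Fin 3, π (![a, b, c] x) < π (![a, b, c] y) ↔ σ x < σ y := by
  constructor
  · rintro ⟨f, hf⟩
    have hf' : ![f 0, f 1, f 2] = f := by
      ext x; fin_cases x <;> rfl
    exact ⟨f 0, f 1, f 2, f.strictMono (by decide), f.strictMono (by decide), by rwa [hf']⟩
  · rintro ⟨a, b, c, hab, hbc, h⟩
    refine ⟨OrderEmbedding.ofStrictMono ![a, b, c] ?_, h⟩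
    have hac := hab.trans hbc
    intro x y hxy
    fin_cases x <;> fin_cases y <;> simp_all

lemma containsPattern_123 {n : ℕ} {π : Equiv.Perm (Fin n)} :
    ContainsPattern ![0, 1, 2] π ↔
      ∃ a b c : Fin n, a < b ∧ b < c ∧ π a < π b ∧ π b < π c := by
  rw [containsPattern_three]
  refine exists_congr fun a => exists_congr fun b => exists_congr fun c =>
    and_congr_right fun _ => and_congr_right fun _ => ?_
  simp [Fin.forall_fin_succ]
  lia

lemma containsPattern_231 {n : ℕ} {π : Equiv.Perm (Fin n)} :
    ContainsPattern ![1, 2, 0] π ↔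
      ∃ a b c : Fin n, a < b ∧ b < c ∧ π c < π a ∧ π a < π b := by
  rw [containsPattern_three]
  refine exists_congr fun a => exists_congr fun b => exists_congr fun c =>
    and_congr_right fun _ => and_congr_right fun _ => ?_
  simp [Fin.forall_fin_succ]
  lia

lemma blockPerm_avoids_123 {n m i : ℕ} (hm : m ≤ i) (hi : i ≤ n) :
    ¬ ContainsPattern ![0, 1, 2] (blockPerm n m i hm hi) := by
  rw [containsPattern_123]
  rintro ⟨a, b, c, hab, hbc, h₁, h₂⟩
  simp only [Fin.lt_def, blockPerm_val, blockWord] at *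
  split_ifs at h₁ h₂ <;> omega

lemma blockPerm_avoids_231 {n m i : ℕ} (hm : m ≤ i) (hi : i ≤ n) :
    ¬ ContainsPattern ![1, 2, 0] (blockPerm n m i hm hi) := by
  rw [containsPattern_231]
  rintro ⟨a, b, c, hab, hbc, h₁, h₂⟩
  simp only [Fin.lt_def, blockPerm_val, blockWord] at *
  split_ifs at h₁ h₂ <;> omega

lemma isAscent_blockPerm {n m i : ℕ} (hm : m < i) (hi : i ≤ n) :
    IsAscent n (blockPerm n m i hm.le hi) i := by
  refine ⟨by omega, hi, ?_⟩
  rcases hi.eq_or_lt with h | h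
  · exact Or.inl h
  · refine Or.inr ⟨h, ?_⟩
    simp only [Fin.lt_def, blockPerm_val, blockWord]
    split_ifs <;> omega

lemma le_of_isAscent_blockPerm {n m i j : ℕ} (hm : m ≤ i) (hi : i ≤ n)
    (h : IsAscent n (blockPerm n m i hm hi) j) : i ≤ j := by
  obtain ⟨h₁, h₂, rfl | ⟨h₃, h₄⟩⟩ := h
  · exact hi
  · simp only [Fin.lt_def, blockPerm_val, blockWord] at h₄
    split_ifs at h₄ <;> omega

lemma blockPerm_inj {n m i m' i' : ℕ} (hm : m < i) (hi : i ≤ n) (hm' : m' < i') (hi' : i' ≤ n)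
    (hn : i = n → m = 0) (hn' : i' = n → m' = 0)
    (h : blockPerm n m i hm.le hi = blockPerm n m' i' hm'.le hi') : i = i' ∧ m = m' := by
  obtain rfl : i = i' := le_antisymm
    (le_of_isAscent_blockPerm hm.le hi (h ▸ isAscent_blockPerm hm' hi'))
    (le_of_isAscent_blockPerm hm'.le hi' (h ▸ isAscent_blockPerm hm hi))
  refine ⟨rfl, ?_⟩
  rcases hi.eq_or_lt with hin | hin
  · rw [hn hin, hn' hin]
  · have := congrArg (fun σ : Equiv.Perm (Fin n) => (σ ⟨i, hin⟩ : ℕ)) h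
    simp only [blockPerm_val, blockWord] at this
    split_ifs at this <;> omega

/-- Letters strictly decrease up to the first ascent. -/
lemma lt_of_lt_first_ascent {n i : ℕ} {π : Equiv.Perm (Fin n)}
    (hmin : ∀ j, IsAscent n π j → i ≤ j) {a b : Fin n} (hab : a < b) (hb : (b : ℕ) < i) :
    π b < π a := by
  obtain ⟨a, ha⟩ := a
  obtain ⟨b, hbn⟩ := b
  simp only [Fin.mk_lt_mk] at hab hb
  induction b, hab using Nat.le_induction with
  | base =>
    by_contra h
    have hne : π ⟨a, ha⟩ ≠ π ⟨a + 1, hbn⟩ := by simp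
    have := hmin (a + 1) ⟨by omega, by omega, Or.inr ⟨hbn, lt_of_le_of_ne (not_lt.mp h) hne⟩⟩
    omega
  | succ b hab ih =>
    refine lt_trans ?_ (ih (by omega) (by omega))
    by_contra h
    have hne : π ⟨b, by omega⟩ ≠ π ⟨b + 1, hbn⟩ := by simp
    have := hmin (b + 1) ⟨by omega, by omega, Or.inr ⟨hbn, lt_of_le_of_ne (not_lt.mp h) hne⟩⟩
    omega

lemma exists_eq_blockPerm {n i : ℕ} {π : Equiv.Perm (Fin n)} (hasc : IsAscent n π i)
    (hmin : ∀ j, IsAscent n π j → i ≤ j) (h123 : ¬ ContainsPattern ![0, 1, 2] π)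
    (h231 : ¬ ContainsPattern ![1, 2, 0] π) :
    ∃ (m : ℕ) (hm : m < i) (hi : i ≤ n), (i = n → m = 0) ∧ blockPerm n m i hm.le hi = π := by
  obtain ⟨hi₁, hi, hin | ⟨hin, hlt⟩⟩ := hasc
  · refine ⟨0, hi₁, hi, fun _ => rfl, Equiv.Perm.eq_of_lt_imp_lt fun a b hab => ?_⟩
    refine lt_of_lt_first_ascent hmin ?_ (by omega)
    simp only [Fin.lt_def, blockPerm_val, blockWord] at hab ⊢
    split_ifs at hab <;> omega
  rw [containsPattern_123] at h123
  rw [containsPattern_231] at h231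
  push Not at h123 h231
  have hne : ∀ a b : Fin n, a < b → π a ≠ π b := fun a b hab h => hab.ne (π.injective h)
  let p : Fin n := ⟨i - 1, by omega⟩
  let q : Fin n := ⟨i, hin⟩
  have hpq : p < q := by simp only [p, q, Fin.lt_def]; omega
  have hdec : ∀ a b : Fin n, i ≤ a → a < b → π b < π a := by
    intro a b ha hab
    have hpa : p < a := by simp only [p, Fin.lt_def]; omega
    have hlow : π p < π a := by
      rcases (show q ≤ a from ha).eq_or_lt with rfl | hqa
      · exact hlt
      · exact lt_of_le_of_ne (not_lt.mp fun h => (h231 p q a hpq hqa h).not_gt hlt) (hne _ _ hpa)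
    exact lt_of_le_of_ne (h123 p a b hpa hab hlow) (hne _ _ hab).symm
  have hex : ∃ m, ∃ h : m < n, π ⟨m, h⟩ < π q := ⟨i - 1, p.2, hlt⟩
  obtain ⟨hmn, hmq⟩ := Nat.find_spec hex
  have hmi : Nat.find hex < i := by
    have : Nat.find hex ≤ i - 1 := Nat.find_min' hex ⟨p.2, hlt⟩
    omega
  have hbefore : ∀ a : Fin n, (a : ℕ) < Nat.find hex → π q < π a := by
    intro a ha
    have := Nat.find_min hex ha
    push Not at this
    exact lt_of_le_of_ne (this a.2) (hne a q (by simp only [q, Fin.lt_def]; omega)).symm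
  generalize Nat.find hex = m at *
  have hsep : ∀ a b : Fin n, m ≤ a → (a : ℕ) < i → i ≤ b → π a < π b := by
    intro a b hma hai hib
    have haq : a < q := hai
    have haq' : π a < π q := by
      rcases (show (⟨m, hmn⟩ : Fin n) ≤ a from hma).eq_or_lt with h | h
      · exact h ▸ hmq
      · exact (lt_of_lt_first_ascent hmin h hai).trans hmq
    rcases (show q ≤ b from hib).eq_or_lt with rfl | hqb
    · exact haq'
    · exact lt_of_le_of_ne (not_lt.mp fun h => (h231 a q b haq hqb h).not_gt haq')
        (hne _ _ (haq.trans hqb))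
  have hsuffix : ∀ b : Fin n, i ≤ b → π b ≤ π q := by
    intro b hib
    rcases (show q ≤ b from hib).eq_or_lt with rfl | hqb
    · exact le_rfl
    · exact (hdec q b le_rfl hqb).le
  refine ⟨m, hmi, hi, fun h => absurd h hin.ne, Equiv.Perm.eq_of_lt_imp_lt fun a b hab => ?_⟩
  simp only [Fin.lt_def, blockPerm_val, blockWord] at hab
  by_cases hai : (a : ℕ) < i <;> by_cases hbi : (b : ℕ) < i
  · refine lt_of_lt_first_ascent hmin ?_ hai
    rw [Fin.lt_def]
    split_ifs at hab <;> omega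
  · refine hsep a b ?_ hai (by omega)
    by_contra h
    split_ifs at hab <;> omega
  · refine (hsuffix a (by omega)).trans_lt (hbefore b ?_)
    by_contra h
    split_ifs at hab <;> omega
  · refine hdec b a (by omega) ?_
    rw [Fin.lt_def]
    split_ifs at hab <;> omega

/-- The pairs `(i, m)` such that `blockPerm n m i` is a desarrangement with first ascent `i`,
normalised by `m = 0` when `i = n`. -/
def blockIndices (n : ℕ) : Finset (Σ _ : ℕ, ℕ) :=
  ((Finset.range (n + 1)).filter Even).sigma fun i => if i = n then {0} else Finset.range i

lemma mem_blockIndices {n : ℕ} (hn : n ≠ 0) {x : Σ _ : ℕ, ℕ} :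
    x ∈ blockIndices n ↔ Even x.1 ∧ x.2 < x.1 ∧ x.1 ≤ n ∧ (x.1 = n → x.2 = 0) := by
  obtain ⟨i, m⟩ := x
  by_cases h : i = n
  · simp [blockIndices, h]
    intros; omega
  · simp [blockIndices, h]
    lia

lemma dcount_eq_card_blockIndices {n : ℕ} (hn : n ≠ 0) :
    dcount n {![0, 1, 2], ![1, 2, 0]} = (blockIndices n).card := by
  symm
  refine Finset.card_bij
    (fun x hx => blockPerm n x.2 x.1 ((mem_blockIndices hn).1 hx).2.1.le
      ((mem_blockIndices hn).1 hx).2.2.1) ?_ ?_ ?_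
  · intro x hx
    obtain ⟨he, hm, hi, -⟩ := (mem_blockIndices hn).1 hx
    simp only [Finset.mem_filter, Finset.mem_univ, true_and, Finset.forall_mem_insert,
      Finset.mem_singleton, forall_eq]
    exact ⟨Or.inr ⟨x.1, isAscent_blockPerm hm hi, he, fun j => le_of_isAscent_blockPerm hm.le hi⟩,
      blockPerm_avoids_123 hm.le hi, blockPerm_avoids_231 hm.le hi⟩
  · rintro ⟨i, m⟩ hx ⟨i', m'⟩ hx' h
    obtain ⟨-, hm, hi, h0⟩ := (mem_blockIndices hn).1 hx
    obtain ⟨-, hm', hi', h0'⟩ := (mem_blockIndices hn).1 hx'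
    obtain ⟨rfl, rfl⟩ := blockPerm_inj hm hi hm' hi' h0 h0' h
    rfl
  · intro π hπ
    simp only [Finset.mem_filter, Finset.mem_univ, true_and, Finset.forall_mem_insert,
      Finset.mem_singleton, forall_eq] at hπ
    obtain ⟨h0 | ⟨i, hasc, he, hmin⟩, h123, h231⟩ := hπ
    · exact absurd h0 hn
    · obtain ⟨m, hm, hi, h0, h⟩ := exists_eq_blockPerm hasc hmin h123 h231
      exact ⟨⟨i, m⟩, (mem_blockIndices hn).2 ⟨he, hm, hi, h0⟩, h⟩

lemma card_blockIndices (n : ℕ) :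
    (blockIndices n).card =
      (∑ i ∈ Finset.range n, if Even i then i else 0) + if Even n then 1 else 0 := by
  rw [blockIndices, Finset.card_sigma, Finset.sum_filter, Finset.sum_range_succ]
  congr 1
  · refine Finset.sum_congr rfl fun i hi => ?_
    simp [(Finset.mem_range.1 hi).ne]
  · simp

lemma eight_mul_sum_even (n : ℕ) :
    (8 : ℤ) * ((∑ i ∈ Finset.range n, if Even i then i else 0 : ℕ) : ℤ) =
      2 * (n : ℤ) * ((n : ℤ) - 1) + (1 - 2 * (n : ℤ)) * (-1) ^ n - 1 := by
  induction n with
  | zero => simp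
  | succ n ih =>
    rw [Finset.sum_range_succ, Nat.cast_add, mul_add, ih, pow_succ]
    rcases Nat.even_or_odd n with h | h
    · simp only [h, if_true, h.neg_one_pow]; push_cast; ring
    · simp only [Nat.not_even_iff_odd.2 h, if_false, h.neg_one_pow]; push_cast; ring

lemma dcount_zero (P : Finset (Fin 3 → Fin 3)) : dcount 0 P = 1 := by
  rw [dcount, Finset.filter_true_of_mem]
  · simp
  · exact fun π _ => ⟨Or.inl rfl, fun σ _ ⟨f, _⟩ => (f 0).elim0⟩

/-- For every integer `n ≥ 0`, `8·d_n({123, 231}) = 2n(n − 1) + (5 − 2n)·(−1)^n + 3`. -/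
theorem desarrangements_avoiding_123_231 (n : ℕ) :
    (8 : ℤ) * dcount n {![0,1,2], ![1,2,0]} =
      2 * (n : ℤ) * ((n : ℤ) - 1) + (5 - 2 * (n : ℤ)) * (-1) ^ n + 3 := by
  rcases eq_or_ne n 0 with rfl | hn
  · simp [dcount_zero]
  · rw [dcount_eq_card_blockIndices hn, card_blockIndices, Nat.cast_add, mul_add,
      eight_mul_sum_even]
    rcases Nat.even_or_odd n with h | h
    · simp only [h, if_true, h.neg_one_pow]; push_cast; ring
    · simp only [Nat.not_even_iff_odd.2 h, if_false, h.neg_one_pow]; push_cast; ring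
end
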